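/- Let w₁₁, w₁₂, w₂₁, w₂₂, w₃₃ be real numbers and define the 4×4 complex matrix ρ := (1/4)(I₄ + w₁₁ σ₁⊗σ₁ + w₁₂ σ₁⊗σ₂ + w₂₁ σ₂⊗σ₁ + w₂₂ σ₂⊗σ₂ + w₃₃ σ₃⊗σ₃). Then the eigenvalues of ρ, counted with multiplicity, are (1/4)(1 + w₃₃ + r₊), (1/4)(1 + w₃₃ − r₊), (1/4)(1 − w₃₃ + r₋), (1/4)(1 − w₃₃ − r₋), where r₊ := √((w₁₁ − w₂₂)² + (w₁₂ + w₂₁)²) and r₋ := √((w₁₁ + w₂₂)² + (w₁₂ − w₂₁)²). -/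

import Mathlib

open Matrix Kronecker Real ComplexOrder

noncomputable section

def σ1 : Matrix (Fin 2) (Fin 2) ℂ := !![0, 1; 1, 0]
def σ2 : Matrix (Fin 2) (Fin 2) ℂ := !![0, -Complex.I; Complex.I, 0]
def σ3 : Matrix (Fin 2) (Fin 2) ℂ := !![1, 0; 0, -1]

/-- For `a ∈ ℝ³`, `a·σ := a₁σ₁ + a₂σ₂ + a₃σ₃`. -/
def dotSigma (a : Fin 3 → ℝ) : Matrix (Fin 2) (Fin 2) ℂ :=
  (a 0 : ℂ) • σ1 + (a 1 : ℂ) • σ2 + (a 2 : ℂ) • σ3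

/-- Euclidean dot product on `ℝ³`. -/
def dot3 (a b : Fin 3 → ℝ) : ℝ := a 0 * b 0 + a 1 * b 1 + a 2 * b 2

/-- A density matrix on `ℂ² ⊗ ℂ²`: positive semidefinite with trace 1. -/
def IsDensityMatrix (ρ : Matrix (Fin 2 × Fin 2) (Fin 2 × Fin 2) ℂ) : Prop :=
  ρ.PosSemidef ∧ ρ.trace = 1

/-- The matrix `F_{α,β}`. -/
def Fmat (α β : ℝ) : Matrix (Fin 4) (Fin 4) ℝ :=
  (1 / (Real.sin α ^ 2 * Real.sin β ^ 2)) •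
    !![1, -Real.cos α, -Real.cos β, Real.cos (α + β);
       -Real.cos α, 1, Real.cos (α - β), -Real.cos β;
       -Real.cos β, Real.cos (α - β), 1, -Real.cos α;
       Real.cos (α + β), -Real.cos β, -Real.cos α, 1]

/-- The quadratic form `γᵀ F_{α,β} γ`. -/
def quadForm (α β : ℝ) (γ : Fin 4 → ℝ) : ℝ := γ ⬝ᵥ (Fmat α β *ᵥ γ)

/-- The matrix `ρ = (1/4)(I₄ + w₁₁ σ₁⊗σ₁ + w₁₂ σ₁⊗σ₂ + w₂₁ σ₂⊗σ₁ + w₂₂ σ₂⊗σ₂ + w₃₃ σ₃⊗σ₃)`. -/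
def rhoW (w11 w12 w21 w22 w33 : ℝ) : Matrix (Fin 2 × Fin 2) (Fin 2 × Fin 2) ℂ :=
  (1 / 4 : ℂ) • ((1 : Matrix (Fin 2 × Fin 2) (Fin 2 × Fin 2) ℂ) +
    (w11 : ℂ) • (σ1 ⊗ₖ σ1) + (w12 : ℂ) • (σ1 ⊗ₖ σ2) +
    (w21 : ℂ) • (σ2 ⊗ₖ σ1) + (w22 : ℂ) • (σ2 ⊗ₖ σ2) + (w33 : ℂ) • (σ3 ⊗ₖ σ3))

/-- Explicit form of `rhoW` on `Fin 4`. -/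
lemma rhoW_reindex (w11 w12 w21 w22 w33 : ℝ) :
    Matrix.reindex finProdFinEquiv finProdFinEquiv (rhoW w11 w12 w21 w22 w33) =
      (!![((1 + w33) / 4 : ℂ), 0, 0, ((w11 - w22) - Complex.I * (w12 + w21)) / 4;
        0, (1 - w33) / 4, ((w11 + w22) + Complex.I * (w12 - w21)) / 4, 0;
        0, ((w11 + w22) - Complex.I * (w12 - w21)) / 4, (1 - w33) / 4, 0;
        ((w11 - w22) + Complex.I * (w12 + w21)) / 4, 0, 0, (1 + w33) / 4] :
        Matrix (Fin (2 * 2)) (Fin (2 * 2)) ℂ) := by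
  have hI : Complex.I * Complex.I = -1 := Complex.I_mul_I
  ext i j
  have h0 : (finProdFinEquiv (m := 2) (n := 2)).symm 0 = (0, 0) := by decide
  have h1 : (finProdFinEquiv (m := 2) (n := 2)).symm 1 = (0, 1) := by decide
  have h2 : (finProdFinEquiv (m := 2) (n := 2)).symm 2 = (1, 0) := by decide
  have h3 : (finProdFinEquiv (m := 2) (n := 2)).symm 3 = (1, 1) := by decide
  rw [Matrix.reindex_apply, Matrix.submatrix_apply]
  change Fin 4 at i j
  fin_cases i <;> fin_cases j <;>
    simp [-finProdFinEquiv_symm_apply, h0, h1, h2, h3, rhoW, σ1, σ2, σ3, Matrix.one_apply] <;> ring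

/-- Characteristic polynomial of an X-shaped matrix. -/
lemma charpoly_X (a b c d e f : ℂ) :
    (!![a, 0, 0, c; 0, b, e, 0; 0, f, b, 0; d, 0, 0, a] :
        Matrix (Fin 4) (Fin 4) ℂ).charpoly =
      ((Polynomial.X - Polynomial.C a) ^ 2 - Polynomial.C (c * d)) *
      ((Polynomial.X - Polynomial.C b) ^ 2 - Polynomial.C (e * f)) := by
  rw [Matrix.charpoly, Matrix.det_succ_row_zero]
  simp [Fin.sum_univ_succ, Matrix.det_fin_three, Matrix.charmatrix_apply, Fin.succAbove,
    Matrix.diagonal_apply]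
  ring

/-- Difference of squares. -/
lemma factor_sq (a r p : ℂ) (h : r ^ 2 = p) :
    (Polynomial.X - Polynomial.C a) ^ 2 - Polynomial.C p =
      (Polynomial.X - Polynomial.C (a + r)) * (Polynomial.X - Polynomial.C (a - r)) := by
  subst h
  simp only [map_add, map_sub, map_pow]
  ring

/-- The eigenvalues of `ρ`, counted with multiplicity (i.e. the
factorization of the characteristic polynomial), are `(1 ± w₃₃ ± r₊/₋)/4`. -/
theorem stmt9 (w11 w12 w21 w22 w33 : ℝ) :
    (rhoW w11 w12 w21 w22 w33).charpoly =
      (Polynomial.X - Polynomial.C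
          (((1 + w33 + Real.sqrt ((w11 - w22) ^ 2 + (w12 + w21) ^ 2)) / 4 : ℝ) : ℂ)) *
      ((Polynomial.X - Polynomial.C
          (((1 + w33 - Real.sqrt ((w11 - w22) ^ 2 + (w12 + w21) ^ 2)) / 4 : ℝ) : ℂ)) *
      ((Polynomial.X - Polynomial.C
          (((1 - w33 + Real.sqrt ((w11 + w22) ^ 2 + (w12 - w21) ^ 2)) / 4 : ℝ) : ℂ)) *
      (Polynomial.X - Polynomial.C
          (((1 - w33 - Real.sqrt ((w11 + w22) ^ 2 + (w12 - w21) ^ 2)) / 4 : ℝ) : ℂ)))) := by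
  rw [← Matrix.charpoly_reindex finProdFinEquiv, rhoW_reindex]
  have hp : ((√((w11 - w22) ^ 2 + (w12 + w21) ^ 2) : ℝ) : ℂ) ^ 2 =
      ((w11 - w22) ^ 2 + (w12 + w21) ^ 2 : ℂ) := by
    rw [← Complex.ofReal_pow, Real.sq_sqrt (by positivity)]
    push_cast
    ring
  have hm : ((√((w11 + w22) ^ 2 + (w12 - w21) ^ 2) : ℝ) : ℂ) ^ 2 =
      ((w11 + w22) ^ 2 + (w12 - w21) ^ 2 : ℂ) := by
    rw [← Complex.ofReal_pow, Real.sq_sqrt (by positivity)]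
    push_cast
    ring
  generalize √((w11 - w22) ^ 2 + (w12 + w21) ^ 2) = r at *
  generalize √((w11 + w22) ^ 2 + (w12 - w21) ^ 2) = s at *
  refine (charpoly_X _ _ _ _ _ _).trans ?_
  rw [factor_sq _ ((r : ℂ) / 4) _ (by
      rw [div_pow, hp]; linear_combination (-(w12 + w21 : ℂ) ^ 2 / 16) * -Complex.I_sq),
    factor_sq _ ((s : ℂ) / 4) _ (by
      rw [div_pow, hm]; linear_combination (-(w12 - w21 : ℂ) ^ 2 / 16) * -Complex.I_sq)]
  push_cast
  simp only [add_div, sub_div]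
  ring
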